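/- Let t be a plain term of λF_{S,v} with Γ;Δ,T ⊢ t : S,U, where Γ = x1:T1,…,xn:Tn and Δ = k1:C1,…,km:Cm with C_i = ¬(W_i^1, W_i^2). Let {α1,…,αp} = ftv(S) ∪ ftv(T) ∪ ftv(U) ∪ ftv(Γ) ∪ ftv(Δ), let V̄ be a sequence of p types, and let R̄ be reducibility candidates with R_i ∈ RC(V_i). Let v̄ be closed values such that, for each i, ;·,W ⊢ v_i : T_i[ᾱ:=V̄], W (for any W) and v_i ∈ RED_{T_i}(ᾱ↦R̄). Let Ē be closed contexts with ⊢ E_i : C_i and (RED_{W_i^1}(ᾱ↦R̄), RED_{W_i^2}(ᾱ↦R̄)) ⊨ E_i for each i. Let E be a closed context with ⊢ E : ¬(S,T) and (RED_S(ᾱ↦R̄), RED_T(ᾱ↦R̄)) ⊨ E, and let F be a closed metacontext with ⊢ F : ¬¬U and RED_U(ᾱ↦R̄) ⊨⊨ F. Then norm(F[⟨E[t[ᾱ:=V̄][x̄:=v̄][k̄:=⌈Ē⌉]]⟩]) holds. -/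

import Mathlib

/-!
Language `λF_{S,v}`: explicitly typed System F extended with the
delimited-control operators shift (`S k.t`), reset (`⟨t⟩`) and throw
(`k ← t`, `⌈E⌉ ← t`), under call by value, in de Bruijn representation
(separate de Bruijn indices for term variables, continuation variables and
type variables).
-/

namespace LambdaFShift

/-- Term types: `S ::= α | (S/T → U/V) | ∀α.(S,T,U)`.
In `∀α.(S,T,U)` the quantifier binds `α` in all three components. -/
inductive Ty : Type where
  | var : Nat → Ty
  | arrow : Ty → Ty → Ty → Ty → Ty
  | all : Ty → Ty → Ty → Ty

/-- Lifting of a renaming under a binder. -/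
def liftRen (ρ : Nat → Nat) : Nat → Nat
  | 0 => 0
  | n+1 => ρ n + 1

/-- Renaming of type variables in a type. -/
def renTy (ρ : Nat → Nat) : Ty → Ty
  | .var n => .var (ρ n)
  | .arrow a b c d => .arrow (renTy ρ a) (renTy ρ b) (renTy ρ c) (renTy ρ d)
  | .all a b c => .all (renTy (liftRen ρ) a) (renTy (liftRen ρ) b) (renTy (liftRen ρ) c)

/-- Lifting of a type substitution under a type binder. -/
def liftTySub (σ : Nat → Ty) : Nat → Ty
  | 0 => .var 0
  | n+1 => renTy Nat.succ (σ n)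

/-- Simultaneous substitution of types for type variables in a type. -/
def subTy (σ : Nat → Ty) : Ty → Ty
  | .var n => σ n
  | .arrow a b c d => .arrow (subTy σ a) (subTy σ b) (subTy σ c) (subTy σ d)
  | .all a b c => .all (subTy (liftTySub σ) a) (subTy (liftTySub σ) b) (subTy (liftTySub σ) c)

/-- `subTy0 U S` is `S[α₀ := U]`. -/
def subTy0 (U : Ty) (S : Ty) : Ty :=
  subTy (fun n => match n with | 0 => U | n+1 => .var n) S

/-- `subTyList Ts S` is `S[ᾱ := Ts]`. -/
def subTyList (Ts : List Ty) (S : Ty) : Ty :=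
  subTy (fun n => Ts.getD n (.var n)) S

/-- `ScopedTy p S`: all free type variables of `S` are `< p`. -/
inductive ScopedTy : Nat → Ty → Prop where
  | var : ∀ {p n}, n < p → ScopedTy p (.var n)
  | arrow : ∀ {p a b c d}, ScopedTy p a → ScopedTy p b → ScopedTy p c → ScopedTy p d →
      ScopedTy p (.arrow a b c d)
  | all : ∀ {p a b c}, ScopedTy (p+1) a → ScopedTy (p+1) b → ScopedTy (p+1) c →
      ScopedTy p (.all a b c)

/-- A closed type. -/
def ClosedTy (S : Ty) : Prop := ScopedTy 0 S

mutual
/-- Terms of `λF_{S,v}`: variables, `λx:S.t`, application, `Λα.t`, type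
application, `S k.t` (shift), `⟨t⟩` (reset), `k ← t` and `⌈E⌉ ← t` (throw). -/
inductive Tm : Type where
  | var : Nat → Tm
  | lam : Ty → Tm → Tm
  | app : Tm → Tm → Tm
  | tlam : Tm → Tm
  | tapp : Tm → Ty → Tm
  | shift : Tm → Tm
  | reset : Tm → Tm
  | throwVar : Nat → Tm → Tm
  | throwCtx : Ctx → Tm → Tm

/-- Call-by-value evaluation contexts, represented inside-out:
`[]`, `(λx:S.t)·E`, `E t`, `E S`, `⌈E₀⌉ ← E`. -/
inductive Ctx : Type where
  | hole : Ctx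
  | lamApp : Ty → Tm → Ctx → Ctx
  | app : Ctx → Tm → Ctx
  | tapp : Ctx → Ty → Ctx
  | throw : Ctx → Ctx → Ctx
end

/-- Metacontexts: stacks of contexts, `F ::= • | E·F`. -/
abbrev MCtx : Type := List Ctx

/-- Plugging a term in a context. -/
def plug : Tm → Ctx → Tm
  | t, .hole => t
  | t, .lamApp S b E => plug (.app (.lam S b) t) E
  | t, .app E u => plug (.app t u) E
  | t, .tapp E S => plug (.tapp t S) E
  | t, .throw E0 E => plug (.throwCtx E0 t) E

/-- Plugging a term in a metacontext:
`plugm t • = t` and `plugm t (E·F) = plugm ⟨E[t]⟩ F`.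
In particular `plugm t (E::F)` is `F[⟨E[t]⟩]`. -/
def plugm : Tm → MCtx → Tm
  | t, [] => t
  | t, E :: F => plugm (.reset (plug t E)) F

/-- Values: λ-abstractions and Λ-abstractions. -/
inductive IsValue : Tm → Prop where
  | lam : ∀ {S t}, IsValue (.lam S t)
  | tlam : ∀ {t}, IsValue (.tlam t)

/-- Plain terms: no subterm of the form `⌈E⌉ ← t`. -/
inductive Plain : Tm → Prop where
  | var : ∀ {n}, Plain (.var n)
  | lam : ∀ {S t}, Plain t → Plain (.lam S t)
  | app : ∀ {a b}, Plain a → Plain b → Plain (.app a b)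
  | tlam : ∀ {t}, Plain t → Plain (.tlam t)
  | tapp : ∀ {t S}, Plain t → Plain (.tapp t S)
  | shift : ∀ {t}, Plain t → Plain (.shift t)
  | reset : ∀ {t}, Plain t → Plain (.reset t)
  | throwVar : ∀ {k t}, Plain t → Plain (.throwVar k t)

mutual
/-- Scoping predicate for terms: free term variables `< n`, free continuation
variables `< m`, free type variables `< p`. -/
inductive ScTm : Nat → Nat → Nat → Tm → Prop where
  | var : ∀ {n m p x}, x < n → ScTm n m p (.var x)
  | lam : ∀ {n m p S t}, ScopedTy p S → ScTm (n+1) m p t → ScTm n m p (.lam S t)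
  | app : ∀ {n m p a b}, ScTm n m p a → ScTm n m p b → ScTm n m p (.app a b)
  | tlam : ∀ {n m p t}, ScTm n m (p+1) t → ScTm n m p (.tlam t)
  | tapp : ∀ {n m p t S}, ScTm n m p t → ScopedTy p S → ScTm n m p (.tapp t S)
  | shift : ∀ {n m p t}, ScTm n (m+1) p t → ScTm n m p (.shift t)
  | reset : ∀ {n m p t}, ScTm n m p t → ScTm n m p (.reset t)
  | throwVar : ∀ {n m p k t}, k < m → ScTm n m p t → ScTm n m p (.throwVar k t)
  | throwCtx : ∀ {n m p E t}, ScCtx n m p E → ScTm n m p t → ScTm n m p (.throwCtx E t)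

/-- Scoping predicate for contexts. -/
inductive ScCtx : Nat → Nat → Nat → Ctx → Prop where
  | hole : ∀ {n m p}, ScCtx n m p .hole
  | lamApp : ∀ {n m p S t E}, ScopedTy p S → ScTm (n+1) m p t → ScCtx n m p E →
      ScCtx n m p (.lamApp S t E)
  | app : ∀ {n m p E t}, ScCtx n m p E → ScTm n m p t → ScCtx n m p (.app E t)
  | tapp : ∀ {n m p E S}, ScCtx n m p E → ScopedTy p S → ScCtx n m p (.tapp E S)
  | throw : ∀ {n m p E0 E1}, ScCtx n m p E0 → ScCtx n m p E1 → ScCtx n m p (.throw E0 E1)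
end

/-- A closed term. -/
def ClosedTm (t : Tm) : Prop := ScTm 0 0 0 t

/-- A closed context. -/
def ClosedCtx (E : Ctx) : Prop := ScCtx 0 0 0 E

/-- A closed metacontext. -/
def ClosedMCtx (F : MCtx) : Prop := ∀ E ∈ F, ClosedCtx E

mutual
/-- Renaming of the three kinds of variables in terms. -/
def renTm (ρx ρk ρa : Nat → Nat) : Tm → Tm
  | .var n => .var (ρx n)
  | .lam S t => .lam (renTy ρa S) (renTm (liftRen ρx) ρk ρa t)
  | .app a b => .app (renTm ρx ρk ρa a) (renTm ρx ρk ρa b)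
  | .tlam t => .tlam (renTm ρx ρk (liftRen ρa) t)
  | .tapp t S => .tapp (renTm ρx ρk ρa t) (renTy ρa S)
  | .shift t => .shift (renTm ρx (liftRen ρk) ρa t)
  | .reset t => .reset (renTm ρx ρk ρa t)
  | .throwVar k t => .throwVar (ρk k) (renTm ρx ρk ρa t)
  | .throwCtx E t => .throwCtx (renCtx ρx ρk ρa E) (renTm ρx ρk ρa t)

/-- Renaming of the three kinds of variables in contexts. -/
def renCtx (ρx ρk ρa : Nat → Nat) : Ctx → Ctx
  | .hole => .hole
  | .lamApp S t E => .lamApp (renTy ρa S) (renTm (liftRen ρx) ρk ρa t) (renCtx ρx ρk ρa E)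
  | .app E t => .app (renCtx ρx ρk ρa E) (renTm ρx ρk ρa t)
  | .tapp E S => .tapp (renCtx ρx ρk ρa E) (renTy ρa S)
  | .throw E0 E => .throw (renCtx ρx ρk ρa E0) (renCtx ρx ρk ρa E)
end

/-- Action of a context transformer on continuation-substitution entries. -/
def mapKEnt (f : Ctx → Ctx) : Ctx ⊕ Nat → Ctx ⊕ Nat
  | .inl E => .inl (f E)
  | .inr n => .inr n

/-- Lifting of a term substitution under a term binder. -/
def liftSubX (σ : Nat → Tm) : Nat → Tm
  | 0 => .var 0
  | n+1 => renTm Nat.succ id id (σ n)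

/-- Shifting of a term substitution under a continuation binder. -/
def shiftSubXk (σ : Nat → Tm) : Nat → Tm := fun n => renTm id Nat.succ id (σ n)

/-- Shifting of a term substitution under a type binder. -/
def shiftSubXa (σ : Nat → Tm) : Nat → Tm := fun n => renTm id id Nat.succ (σ n)

/-- Lifting of a continuation substitution under a continuation binder. -/
def liftSubK (σ : Nat → Ctx ⊕ Nat) : Nat → Ctx ⊕ Nat
  | 0 => .inr 0
  | n+1 =>
    match σ n with
    | .inl E => .inl (renCtx id Nat.succ id E)
    | .inr m => .inr (m+1)

/-- Shifting of a continuation substitution under a term binder. -/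
def shiftSubKx (σ : Nat → Ctx ⊕ Nat) : Nat → Ctx ⊕ Nat :=
  fun n => mapKEnt (renCtx Nat.succ id id) (σ n)

/-- Shifting of a continuation substitution under a type binder. -/
def shiftSubKa (σ : Nat → Ctx ⊕ Nat) : Nat → Ctx ⊕ Nat :=
  fun n => mapKEnt (renCtx id id Nat.succ) (σ n)

mutual
/-- Simultaneous capture-avoiding substitution in terms. -/
def subTm (σx : Nat → Tm) (σk : Nat → Ctx ⊕ Nat) (σa : Nat → Ty) : Tm → Tm
  | .var n => σx n
  | .lam S t => .lam (subTy σa S) (subTm (liftSubX σx) (shiftSubKx σk) σa t)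
  | .app a b => .app (subTm σx σk σa a) (subTm σx σk σa b)
  | .tlam t => .tlam (subTm (shiftSubXa σx) (shiftSubKa σk) (liftTySub σa) t)
  | .tapp t S => .tapp (subTm σx σk σa t) (subTy σa S)
  | .shift t => .shift (subTm (shiftSubXk σx) (liftSubK σk) σa t)
  | .reset t => .reset (subTm σx σk σa t)
  | .throwVar k t =>
    match σk k with
    | .inl E => .throwCtx E (subTm σx σk σa t)
    | .inr m => .throwVar m (subTm σx σk σa t)
  | .throwCtx E t => .throwCtx (subCtx σx σk σa E) (subTm σx σk σa t)

/-- Simultaneous capture-avoiding substitution in contexts. -/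
def subCtx (σx : Nat → Tm) (σk : Nat → Ctx ⊕ Nat) (σa : Nat → Ty) : Ctx → Ctx
  | .hole => .hole
  | .lamApp S t E => .lamApp (subTy σa S) (subTm (liftSubX σx) (shiftSubKx σk) σa t) (subCtx σx σk σa E)
  | .app E t => .app (subCtx σx σk σa E) (subTm σx σk σa t)
  | .tapp E S => .tapp (subCtx σx σk σa E) (subTy σa S)
  | .throw E0 E => .throw (subCtx σx σk σa E0) (subCtx σx σk σa E)
end

/-- `sub0X v t` is `t[x₀ := v]`. -/
def sub0X (v : Tm) (t : Tm) : Tm :=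
  subTm (fun n => match n with | 0 => v | n+1 => .var n) Sum.inr Ty.var t

/-- `sub0A S t` is `t[α₀ := S]`. -/
def sub0A (S : Ty) (t : Tm) : Tm :=
  subTm Tm.var Sum.inr (fun n => match n with | 0 => S | n+1 => .var n) t

/-- `sub0K E t` is `t[k₀ := ⌈E⌉]`. -/
def sub0K (E : Ctx) (t : Tm) : Tm :=
  subTm Tm.var (fun n => match n with | 0 => .inl E | n+1 => .inr n) Ty.var t

/-- `msub Vs vs Es t` is the simultaneous substitution
`t[ᾱ := Vs][x̄ := vs][k̄ := ⌈Es⌉]`. -/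
def msub (Vs : List Ty) (vs : List Tm) (Es : List Ctx) (t : Tm) : Tm :=
  subTm (fun n => vs.getD n (.var n))
        (fun n => match Es[n]? with | some E => .inl E | none => .inr n)
        (fun n => Vs.getD n (.var n)) t

mutual
/-- The type system of Figure 2: typing of terms.
`HasTy Γ Δ T t S U` encodes the judgment `Γ;Δ,T ⊢ t : S,U`, where `Γ` assigns
term types to term variables and `Δ` assigns context types `¬(S,T)`
(represented by the pair `(S,T)`) to continuation variables. -/
inductive HasTy : List Ty → List (Ty × Ty) → Ty → Tm → Ty → Ty → Prop where
  | var : ∀ {Γ Δ x S T}, Γ[x]? = some S → HasTy Γ Δ T (.var x) S T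
  | lam : ∀ {Γ Δ S T U V W t}, HasTy (S::Γ) Δ U t T V →
      HasTy Γ Δ W (.lam S t) (.arrow S T U V) W
  | app : ∀ {Γ Δ S T U V W X t0 t1},
      HasTy Γ Δ X t0 (.arrow S T U W) V → HasTy Γ Δ W t1 S X →
      HasTy Γ Δ U (.app t0 t1) T V
  | tlam : ∀ {Γ Δ S T U V t},
      HasTy (Γ.map (renTy Nat.succ)) (Δ.map (fun C => (renTy Nat.succ C.1, renTy Nat.succ C.2))) T t S U →
      HasTy Γ Δ V (.tlam t) (.all S T U) V
  | tapp : ∀ {Γ Δ S T U V W t},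
      HasTy Γ Δ (subTy0 V U) t (.all S T U) W →
      HasTy Γ Δ (subTy0 V T) (.tapp t V) (subTy0 V S) W
  | reset : ∀ {Γ Δ S T U t}, HasTy Γ Δ U t U S → HasTy Γ Δ T (.reset t) S T
  | shift : ∀ {Γ Δ S T U V t}, HasTy Γ ((S,T)::Δ) V t V U →
      HasTy Γ Δ T (.shift t) S U
  | throwVar : ∀ {Γ Δ k S T U V t}, Δ[k]? = some (S,T) → HasTy Γ Δ U t S V →
      HasTy Γ Δ U (.throwVar k t) T V
  | throwCtx : ∀ {Γ Δ E S T U V t}, HasTyCtx Γ Δ E S T → HasTy Γ Δ U t S V →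
      HasTy Γ Δ U (.throwCtx E t) T V

/-- The type system of Figure 2: typing of contexts.
`HasTyCtx Γ Δ E S T` encodes `Γ;Δ ⊢ E : ¬(S,T)`. -/
inductive HasTyCtx : List Ty → List (Ty × Ty) → Ctx → Ty → Ty → Prop where
  | hole : ∀ {Γ Δ S}, HasTyCtx Γ Δ .hole S S
  | app : ∀ {Γ Δ S T U V W t E},
      HasTyCtx Γ Δ E T U → HasTy Γ Δ V t S W →
      HasTyCtx Γ Δ (.app E t) (.arrow S T U V) W
  | lamApp : ∀ {Γ Δ S T U V W t E},
      HasTy Γ Δ W (.lam S t) (.arrow S T U V) W → HasTyCtx Γ Δ E T U →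
      HasTyCtx Γ Δ (.lamApp S t E) S V
  | tapp : ∀ {Γ Δ S T U V E},
      HasTyCtx Γ Δ E (subTy0 V S) (subTy0 V T) →
      HasTyCtx Γ Δ (.tapp E V) (.all S T U) (subTy0 V U)
  | throw : ∀ {Γ Δ S T U E' E},
      HasTyCtx Γ Δ E' S T → HasTyCtx Γ Δ E T U →
      HasTyCtx Γ Δ (.throw E' E) S U
end

/-- The type system of Figure 2: typing of metacontexts.
`HasTyMCtx Γ Δ F S` encodes `Γ;Δ ⊢ F : ¬¬S`. -/
inductive HasTyMCtx : List Ty → List (Ty × Ty) → MCtx → Ty → Prop where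
  | nil : ∀ {Γ Δ S}, HasTyMCtx Γ Δ ([] : MCtx) S
  | cons : ∀ {Γ Δ S T E F}, HasTyCtx Γ Δ E S T → HasTyMCtx Γ Δ F T →
      HasTyMCtx Γ Δ (E :: F : MCtx) S

/-- The call-by-value one-step reduction relation `→v` of `λF_{S,v}`.
Note that `plugm r (E::F)` is the program `F[⟨E[r]⟩]`. -/
inductive Step : Tm → Tm → Prop where
  | beta : ∀ {S t v E F}, IsValue v →
      Step (plugm (.app (.lam S t) v) (E::F)) (plugm (sub0X v t) (E::F))
  | betaT : ∀ {t S E F},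
      Step (plugm (.tapp (.tlam t) S) (E::F)) (plugm (sub0A S t) (E::F))
  | shift : ∀ {t E F},
      Step (plugm (.shift t) (E::F)) (plugm (.reset (sub0K E t)) F)
  | throw : ∀ {E' E F v}, IsValue v →
      Step (plugm (.throwCtx E' v) (E::F)) (plugm v (E'::E::F))
  | reset : ∀ {v E F}, IsValue v →
      Step (plugm (.reset v) (E::F)) (plugm v (E::F))

/-- Call-by-value evaluation: the reflexive-transitive closure of `→v`. -/
def Steps : Tm → Tm → Prop := Relation.ReflTransGen Step

/-- Redexes of `λF_{S,v}` under call by value. -/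
inductive IsRedex : Tm → Prop where
  | beta : ∀ {S t v}, IsValue v → IsRedex (.app (.lam S t) v)
  | betaT : ∀ {t S}, IsRedex (.tapp (.tlam t) S)
  | shift : ∀ {t}, IsRedex (.shift t)
  | throw : ∀ {E v}, IsValue v → IsRedex (.throwCtx E v)
  | reset : ∀ {v}, IsValue v → IsRedex (.reset v)

/-- `Norm p`: the program `p` evaluates to a value delimited by a reset. -/
def Norm (p : Tm) : Prop := ∃ v, IsValue v ∧ Steps p (.reset v)

/-- A reducibility candidate of type `S` is a set of closed values of type `S`. -/
def IsCand (S : Ty) (R : Set Tm) : Prop :=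
  ∀ v ∈ R, IsValue v ∧ ClosedTm v ∧ ∀ W, HasTy [] [] W v S W

/-- `MCtxOK R F` is the predicate `R ⊨⊨ F`, i.e. `∀ v ∈ R, norm (F[⟨v⟩])`. -/
def MCtxOK (R : Set Tm) (F : MCtx) : Prop := ∀ v ∈ R, Norm (plugm (.reset v) F)

/-- `MCtxAdm U R F`: `F` is a closed metacontext of type `¬¬U` with `R ⊨⊨ F`. -/
def MCtxAdm (U : Ty) (R : Set Tm) (F : MCtx) : Prop :=
  ClosedMCtx F ∧ HasTyMCtx [] [] F U ∧ MCtxOK R F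

/-- `CtxOK T R R' E` is the predicate `(R,R') ⊨ E`:
`∀ v ∈ R, ∀ F, R' ⊨⊨ F → norm (F[⟨E[v]⟩])`, where `T` is the type of the
candidate `R'` (so the metacontexts `F` range over closed metacontexts of
type `¬¬T`). -/
def CtxOK (T : Ty) (R R' : Set Tm) (E : Ctx) : Prop :=
  ∀ v ∈ R, ∀ F, MCtxAdm T R' F → Norm (plugm v (E::F))

/-- `CtxAdm S T R R' E`: `E` is a closed context of type `¬(S,T)` with `(R,R') ⊨ E`. -/
def CtxAdm (S T : Ty) (R R' : Set Tm) (E : Ctx) : Prop :=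
  ClosedCtx E ∧ HasTyCtx [] [] E S T ∧ CtxOK T R R' E

/-- The parametric reducibility candidate `RED_S(ᾱ ↦ R̄)` for `λF_{S,v}`,
defined by induction on `S`.  `Ts` are the types of the candidates `Rs`. -/
def RED : Ty → List Ty → List (Set Tm) → Set Tm
  | .var i, _, Rs => Rs.getD i ∅
  | .arrow S T U V, Ts, Rs =>
      {v0 | IsValue v0 ∧ ClosedTm v0 ∧ (∀ W, HasTy [] [] W v0 (subTyList Ts (.arrow S T U V)) W) ∧
        ∀ v1 ∈ RED S Ts Rs,
          ∀ E, CtxAdm (subTyList Ts T) (subTyList Ts U) (RED T Ts Rs) (RED U Ts Rs) E →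
          ∀ F, MCtxAdm (subTyList Ts V) (RED V Ts Rs) F →
            Norm (plugm (.app v0 v1) (E::F))}
  | .all S T U, Ts, Rs =>
      {v | IsValue v ∧ ClosedTm v ∧ (∀ W, HasTy [] [] W v (subTyList Ts (.all S T U)) W) ∧
        ∀ (V : Ty) (Rc : Set Tm), IsCand V Rc →
          ∀ E, CtxAdm (subTyList (V::Ts) S) (subTyList (V::Ts) T)
                 (RED S (V::Ts) (Rc::Rs)) (RED T (V::Ts) (Rc::Rs)) E →
          ∀ F, MCtxAdm (subTyList (V::Ts) U) (RED U (V::Ts) (Rc::Rs)) F →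
            Norm (plugm (.tapp v V) (E::F))}

end LambdaFShift
namespace LambdaFShift


/-! ### Renaming and substitution in types -/

/-- Extension of an environment by a new entry at index `0`. -/
def scons {α : Type*} (a : α) (f : Nat → α) : Nat → α
  | 0 => a
  | n+1 => f n

theorem liftRen_id : liftRen id = id := by
  funext n; cases n <;> rfl

theorem liftRen_comp (ρ' ρ : Nat → Nat) : liftRen ρ' ∘ liftRen ρ = liftRen (ρ' ∘ ρ) := by
  funext n; cases n <;> rfl

theorem renTy_id (S : Ty) : renTy id S = S := by
  induction S <;> simp_all [renTy, liftRen_id]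

theorem renTy_renTy (S : Ty) (ρ' ρ : Nat → Nat) :
    renTy ρ' (renTy ρ S) = renTy (ρ' ∘ ρ) S := by
  induction S generalizing ρ' ρ <;> simp_all [renTy, liftRen_comp]

theorem liftTySub_comp_liftRen (σ : Nat → Ty) (ρ : Nat → Nat) :
    liftTySub σ ∘ liftRen ρ = liftTySub (σ ∘ ρ) := by
  funext n; cases n <;> rfl

theorem subTy_renTy (S : Ty) (σ : Nat → Ty) (ρ : Nat → Nat) :
    subTy σ (renTy ρ S) = subTy (σ ∘ ρ) S := by
  induction S generalizing σ ρ <;> simp_all [renTy, subTy, liftTySub_comp_liftRen]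

theorem renTy_liftRen_comp_liftTySub (ρ : Nat → Nat) (σ : Nat → Ty) :
    renTy (liftRen ρ) ∘ liftTySub σ = liftTySub (renTy ρ ∘ σ) := by
  funext n
  cases n with
  | zero => rfl
  | succ n => simp only [Function.comp, liftTySub, renTy_renTy]; rfl

theorem renTy_subTy (S : Ty) (ρ : Nat → Nat) (σ : Nat → Ty) :
    renTy ρ (subTy σ S) = subTy (renTy ρ ∘ σ) S := by
  induction S generalizing σ ρ <;> simp_all [renTy, subTy, renTy_liftRen_comp_liftTySub]

theorem subTy_liftTySub_comp_liftTySub (τ σ : Nat → Ty) :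
    subTy (liftTySub τ) ∘ liftTySub σ = liftTySub (subTy τ ∘ σ) := by
  funext n
  cases n with
  | zero => rfl
  | succ n => simp only [Function.comp, liftTySub, subTy_renTy, renTy_subTy]; rfl

theorem subTy_subTy (S : Ty) (τ σ : Nat → Ty) :
    subTy τ (subTy σ S) = subTy (subTy τ ∘ σ) S := by
  induction S generalizing σ τ <;> simp_all [subTy, subTy_liftTySub_comp_liftTySub]

theorem liftTySub_var : liftTySub Ty.var = Ty.var := by
  funext n; cases n <;> rfl

theorem subTy_var (S : Ty) : subTy Ty.var S = S := by
  induction S <;> simp_all [subTy, liftTySub_var]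

theorem renTy_id_comp (σ : Nat → Ty) : renTy id ∘ σ = σ :=
  funext fun _ => renTy_id _

/-! ### Renaming and substitution in terms and contexts -/

mutual
theorem renTm_renTm : ∀ (t : Tm) (ρx' ρk' ρa' ρx ρk ρa : Nat → Nat),
    renTm ρx' ρk' ρa' (renTm ρx ρk ρa t) = renTm (ρx' ∘ ρx) (ρk' ∘ ρk) (ρa' ∘ ρa) t
  | .var _, _, _, _, _, _, _ => rfl
  | .lam S t, _, _, _, _, _, _ => by simp [renTm, renTy_renTy, renTm_renTm t, liftRen_comp]
  | .app a b, _, _, _, _, _, _ => by simp [renTm, renTm_renTm a, renTm_renTm b]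
  | .tlam t, _, _, _, _, _, _ => by simp [renTm, renTm_renTm t, liftRen_comp]
  | .tapp t S, _, _, _, _, _, _ => by simp [renTm, renTy_renTy, renTm_renTm t]
  | .shift t, _, _, _, _, _, _ => by simp [renTm, renTm_renTm t, liftRen_comp]
  | .reset t, _, _, _, _, _, _ => by simp [renTm, renTm_renTm t]
  | .throwVar k t, _, _, _, _, _, _ => by simp [renTm, renTm_renTm t]
  | .throwCtx E t, _, _, _, _, _, _ => by simp [renTm, renTm_renTm t, renCtx_renCtx E]

theorem renCtx_renCtx : ∀ (E : Ctx) (ρx' ρk' ρa' ρx ρk ρa : Nat → Nat),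
    renCtx ρx' ρk' ρa' (renCtx ρx ρk ρa E) = renCtx (ρx' ∘ ρx) (ρk' ∘ ρk) (ρa' ∘ ρa) E
  | .hole, _, _, _, _, _, _ => rfl
  | .lamApp S t E, _, _, _, _, _, _ => by
      simp [renCtx, renTy_renTy, renTm_renTm t, renCtx_renCtx E, liftRen_comp]
  | .app E t, _, _, _, _, _, _ => by simp [renCtx, renTm_renTm t, renCtx_renCtx E]
  | .tapp E S, _, _, _, _, _, _ => by simp [renCtx, renTy_renTy, renCtx_renCtx E]
  | .throw E0 E, _, _, _, _, _, _ => by simp [renCtx, renCtx_renCtx E0, renCtx_renCtx E]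
end

theorem liftSubX_comp_liftRen (σ : Nat → Tm) (ρ : Nat → Nat) :
    liftSubX σ ∘ liftRen ρ = liftSubX (σ ∘ ρ) := by
  funext n; cases n <;> rfl

theorem liftSubK_comp_liftRen (σ : Nat → Ctx ⊕ Nat) (ρ : Nat → Nat) :
    liftSubK σ ∘ liftRen ρ = liftSubK (σ ∘ ρ) := by
  funext n; cases n <;> rfl

theorem shiftSubXk_comp (σ : Nat → Tm) (ρ : Nat → Nat) :
    shiftSubXk σ ∘ ρ = shiftSubXk (σ ∘ ρ) := rfl

theorem shiftSubXa_comp (σ : Nat → Tm) (ρ : Nat → Nat) :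
    shiftSubXa σ ∘ ρ = shiftSubXa (σ ∘ ρ) := rfl

theorem shiftSubKx_comp (σ : Nat → Ctx ⊕ Nat) (ρ : Nat → Nat) :
    shiftSubKx σ ∘ ρ = shiftSubKx (σ ∘ ρ) := rfl

theorem shiftSubKa_comp (σ : Nat → Ctx ⊕ Nat) (ρ : Nat → Nat) :
    shiftSubKa σ ∘ ρ = shiftSubKa (σ ∘ ρ) := rfl

mutual
theorem subTm_renTm : ∀ (t : Tm) (σx : Nat → Tm) (σk : Nat → Ctx ⊕ Nat) (σa : Nat → Ty)
    (ρx ρk ρa : Nat → Nat),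
    subTm σx σk σa (renTm ρx ρk ρa t) = subTm (σx ∘ ρx) (σk ∘ ρk) (σa ∘ ρa) t
  | .var _, _, _, _, _, _, _ => rfl
  | .lam S t, _, _, _, _, _, _ => by
      simp [renTm, subTm, subTy_renTy, subTm_renTm t, liftSubX_comp_liftRen, shiftSubKx_comp]
  | .app a b, _, _, _, _, _, _ => by simp [renTm, subTm, subTm_renTm a, subTm_renTm b]
  | .tlam t, _, _, _, _, _, _ => by
      simp [renTm, subTm, subTm_renTm t, liftTySub_comp_liftRen, shiftSubXa_comp, shiftSubKa_comp]
  | .tapp t S, _, _, _, _, _, _ => by simp [renTm, subTm, subTy_renTy, subTm_renTm t]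
  | .shift t, _, _, _, _, _, _ => by
      simp [renTm, subTm, subTm_renTm t, liftSubK_comp_liftRen, shiftSubXk_comp]
  | .reset t, _, _, _, _, _, _ => by simp [renTm, subTm, subTm_renTm t]
  | .throwVar k t, _, _, _, _, _, _ => by simp [renTm, subTm, subTm_renTm t]
  | .throwCtx E t, _, _, _, _, _, _ => by simp [renTm, subTm, subTm_renTm t, subCtx_renCtx E]

theorem subCtx_renCtx : ∀ (E : Ctx) (σx : Nat → Tm) (σk : Nat → Ctx ⊕ Nat) (σa : Nat → Ty)
    (ρx ρk ρa : Nat → Nat),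
    subCtx σx σk σa (renCtx ρx ρk ρa E) = subCtx (σx ∘ ρx) (σk ∘ ρk) (σa ∘ ρa) E
  | .hole, _, _, _, _, _, _ => rfl
  | .lamApp S t E, _, _, _, _, _, _ => by
      simp [renCtx, subCtx, subTy_renTy, subTm_renTm t, subCtx_renCtx E, liftSubX_comp_liftRen,
        shiftSubKx_comp]
  | .app E t, _, _, _, _, _, _ => by simp [renCtx, subCtx, subTm_renTm t, subCtx_renCtx E]
  | .tapp E S, _, _, _, _, _, _ => by simp [renCtx, subCtx, subTy_renTy, subCtx_renCtx E]
  | .throw E0 E, _, _, _, _, _, _ => by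
      simp [renCtx, subCtx, subCtx_renCtx E0, subCtx_renCtx E]
end

/-- Renaming of an entry of a continuation substitution. -/
def renKEnt (ρx ρk ρa : Nat → Nat) : Ctx ⊕ Nat → Ctx ⊕ Nat
  | .inl E => .inl (renCtx ρx ρk ρa E)
  | .inr m => .inr (ρk m)

theorem renTm_liftRen_comp_liftSubX (ρx ρk ρa : Nat → Nat) (σ : Nat → Tm) :
    renTm (liftRen ρx) ρk ρa ∘ liftSubX σ = liftSubX (renTm ρx ρk ρa ∘ σ) := by
  funext n
  cases n with
  | zero => rfl
  | succ n => simp only [Function.comp, liftSubX, renTm_renTm]; rfl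

theorem renTm_comp_shiftSubXk (ρx ρk ρa : Nat → Nat) (σ : Nat → Tm) :
    renTm ρx (liftRen ρk) ρa ∘ shiftSubXk σ = shiftSubXk (renTm ρx ρk ρa ∘ σ) := by
  funext n
  simp only [Function.comp, shiftSubXk, renTm_renTm]; rfl

theorem renTm_comp_shiftSubXa (ρx ρk ρa : Nat → Nat) (σ : Nat → Tm) :
    renTm ρx ρk (liftRen ρa) ∘ shiftSubXa σ = shiftSubXa (renTm ρx ρk ρa ∘ σ) := by
  funext n
  simp only [Function.comp, shiftSubXa, renTm_renTm]; rfl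

theorem renKEnt_comp_liftSubK (ρx ρk ρa : Nat → Nat) (σ : Nat → Ctx ⊕ Nat) :
    renKEnt ρx (liftRen ρk) ρa ∘ liftSubK σ = liftSubK (renKEnt ρx ρk ρa ∘ σ) := by
  funext n
  cases n with
  | zero => rfl
  | succ n =>
    simp only [Function.comp, liftSubK]
    cases σ n <;> simp only [renKEnt, renCtx_renCtx] <;> rfl

theorem renKEnt_comp_shiftSubKx (ρx ρk ρa : Nat → Nat) (σ : Nat → Ctx ⊕ Nat) :
    renKEnt (liftRen ρx) ρk ρa ∘ shiftSubKx σ = shiftSubKx (renKEnt ρx ρk ρa ∘ σ) := by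
  funext n
  simp only [Function.comp, shiftSubKx]
  cases σ n with
  | inr m => rfl
  | inl E => simp only [renKEnt, mapKEnt, renCtx_renCtx]; rfl

theorem renKEnt_comp_shiftSubKa (ρx ρk ρa : Nat → Nat) (σ : Nat → Ctx ⊕ Nat) :
    renKEnt ρx ρk (liftRen ρa) ∘ shiftSubKa σ = shiftSubKa (renKEnt ρx ρk ρa ∘ σ) := by
  funext n
  simp only [Function.comp, shiftSubKa]
  cases σ n with
  | inr m => rfl
  | inl E => simp only [renKEnt, mapKEnt, renCtx_renCtx]; rfl

mutual
theorem renTm_subTm : ∀ (t : Tm) (ρx ρk ρa : Nat → Nat) (σx : Nat → Tm)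
    (σk : Nat → Ctx ⊕ Nat) (σa : Nat → Ty),
    renTm ρx ρk ρa (subTm σx σk σa t) =
      subTm (renTm ρx ρk ρa ∘ σx) (renKEnt ρx ρk ρa ∘ σk) (renTy ρa ∘ σa) t
  | .var _, _, _, _, _, _, _ => rfl
  | .lam S t, _, _, _, _, _, _ => by
      simp [renTm, subTm, renTy_subTy, renTm_subTm t, renTm_liftRen_comp_liftSubX,
        renKEnt_comp_shiftSubKx]
  | .app a b, _, _, _, _, _, _ => by simp [renTm, subTm, renTm_subTm a, renTm_subTm b]
  | .tlam t, _, _, _, _, _, _ => by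
      simp [renTm, subTm, renTm_subTm t, renTy_liftRen_comp_liftTySub, renTm_comp_shiftSubXa,
        renKEnt_comp_shiftSubKa]
  | .tapp t S, _, _, _, _, _, _ => by simp [renTm, subTm, renTy_subTy, renTm_subTm t]
  | .shift t, _, _, _, _, _, _ => by
      simp [renTm, subTm, renTm_subTm t, renKEnt_comp_liftSubK, renTm_comp_shiftSubXk]
  | .reset t, _, _, _, _, _, _ => by simp [renTm, subTm, renTm_subTm t]
  | .throwVar k t, _, _, _, _, σk, _ => by
      simp only [subTm, Function.comp]
      cases σk k <;> simp [renTm, renKEnt, renTm_subTm t, Function.comp_def]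
  | .throwCtx E t, _, _, _, _, _, _ => by simp [renTm, subTm, renTm_subTm t, renCtx_subCtx E]

theorem renCtx_subCtx : ∀ (E : Ctx) (ρx ρk ρa : Nat → Nat) (σx : Nat → Tm)
    (σk : Nat → Ctx ⊕ Nat) (σa : Nat → Ty),
    renCtx ρx ρk ρa (subCtx σx σk σa E) =
      subCtx (renTm ρx ρk ρa ∘ σx) (renKEnt ρx ρk ρa ∘ σk) (renTy ρa ∘ σa) E
  | .hole, _, _, _, _, _, _ => rfl
  | .lamApp S t E, _, _, _, _, _, _ => by
      simp [renCtx, subCtx, renTy_subTy, renTm_subTm t, renCtx_subCtx E,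
        renTm_liftRen_comp_liftSubX, renKEnt_comp_shiftSubKx]
  | .app E t, _, _, _, _, _, _ => by simp [renCtx, subCtx, renTm_subTm t, renCtx_subCtx E]
  | .tapp E S, _, _, _, _, _, _ => by simp [renCtx, subCtx, renTy_subTy, renCtx_subCtx E]
  | .throw E0 E, _, _, _, _, _, _ => by
      simp [renCtx, subCtx, renCtx_subCtx E0, renCtx_subCtx E]
end

/-- Substitution in an entry of a continuation substitution. -/
def subKEnt (τx : Nat → Tm) (τk : Nat → Ctx ⊕ Nat) (τa : Nat → Ty) : Ctx ⊕ Nat → Ctx ⊕ Nat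
  | .inl E => .inl (subCtx τx τk τa E)
  | .inr m => τk m

theorem mapKEnt_renCtx_eq (ρx ρa : Nat → Nat) :
    mapKEnt (renCtx ρx id ρa) = renKEnt ρx id ρa := by
  funext e; cases e <;> rfl

theorem liftSubK_succ (σ : Nat → Ctx ⊕ Nat) (n : Nat) :
    liftSubK σ (n+1) = renKEnt id Nat.succ id (σ n) := by
  simp only [liftSubK]; cases σ n <;> rfl

theorem subTm_comp_liftSubX (τx : Nat → Tm) (τk : Nat → Ctx ⊕ Nat) (τa : Nat → Ty)
    (σ : Nat → Tm) :
    subTm (liftSubX τx) (shiftSubKx τk) τa ∘ liftSubX σ = liftSubX (subTm τx τk τa ∘ σ) := by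
  funext n
  cases n with
  | zero => rfl
  | succ n =>
    simp only [Function.comp_apply, liftSubX, subTm_renTm, renTm_subTm, renTy_id_comp,
      ← mapKEnt_renCtx_eq]
    rfl

theorem subTm_comp_shiftSubXk (τx : Nat → Tm) (τk : Nat → Ctx ⊕ Nat) (τa : Nat → Ty)
    (σ : Nat → Tm) :
    subTm (shiftSubXk τx) (liftSubK τk) τa ∘ shiftSubXk σ = shiftSubXk (subTm τx τk τa ∘ σ) := by
  funext n
  simp only [Function.comp_apply, shiftSubXk, subTm_renTm, renTm_subTm, renTy_id_comp]
  rw [show liftSubK τk ∘ Nat.succ = renKEnt id Nat.succ id ∘ τk from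
    funext (liftSubK_succ τk)]
  rfl

theorem subTm_comp_shiftSubXa (τx : Nat → Tm) (τk : Nat → Ctx ⊕ Nat) (τa : Nat → Ty)
    (σ : Nat → Tm) :
    subTm (shiftSubXa τx) (shiftSubKa τk) (liftTySub τa) ∘ shiftSubXa σ =
      shiftSubXa (subTm τx τk τa ∘ σ) := by
  funext n
  simp only [Function.comp_apply, shiftSubXa, subTm_renTm, renTm_subTm, ← mapKEnt_renCtx_eq]
  rfl

theorem subKEnt_comp_liftSubK (τx : Nat → Tm) (τk : Nat → Ctx ⊕ Nat) (τa : Nat → Ty)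
    (σ : Nat → Ctx ⊕ Nat) :
    subKEnt (shiftSubXk τx) (liftSubK τk) τa ∘ liftSubK σ = liftSubK (subKEnt τx τk τa ∘ σ) := by
  funext n
  cases n with
  | zero => rfl
  | succ n =>
    simp only [Function.comp_apply, liftSubK_succ]
    cases σ n with
    | inr m => exact liftSubK_succ τk m
    | inl E =>
      simp only [subKEnt, renKEnt, subCtx_renCtx, renCtx_subCtx, renTy_id_comp]
      rw [show liftSubK τk ∘ Nat.succ = renKEnt id Nat.succ id ∘ τk from
        funext (liftSubK_succ τk)]
      rfl

theorem subKEnt_comp_shiftSubKx (τx : Nat → Tm) (τk : Nat → Ctx ⊕ Nat) (τa : Nat → Ty)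
    (σ : Nat → Ctx ⊕ Nat) :
    subKEnt (liftSubX τx) (shiftSubKx τk) τa ∘ shiftSubKx σ =
      shiftSubKx (subKEnt τx τk τa ∘ σ) := by
  funext n
  simp only [Function.comp_apply, shiftSubKx]
  cases σ n with
  | inr m => rfl
  | inl E =>
    simp only [subKEnt, mapKEnt, subCtx_renCtx, renCtx_subCtx, renTy_id_comp]
    rw [← mapKEnt_renCtx_eq]
    rfl

theorem subKEnt_comp_shiftSubKa (τx : Nat → Tm) (τk : Nat → Ctx ⊕ Nat) (τa : Nat → Ty)
    (σ : Nat → Ctx ⊕ Nat) :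
    subKEnt (shiftSubXa τx) (shiftSubKa τk) (liftTySub τa) ∘ shiftSubKa σ =
      shiftSubKa (subKEnt τx τk τa ∘ σ) := by
  funext n
  simp only [Function.comp_apply, shiftSubKa]
  cases σ n with
  | inr m => rfl
  | inl E =>
    simp only [subKEnt, mapKEnt, subCtx_renCtx, renCtx_subCtx]
    rw [← mapKEnt_renCtx_eq]
    rfl

mutual
theorem subTm_subTm : ∀ (t : Tm) (τx : Nat → Tm) (τk : Nat → Ctx ⊕ Nat) (τa : Nat → Ty)
    (σx : Nat → Tm) (σk : Nat → Ctx ⊕ Nat) (σa : Nat → Ty),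
    subTm τx τk τa (subTm σx σk σa t) =
      subTm (subTm τx τk τa ∘ σx) (subKEnt τx τk τa ∘ σk) (subTy τa ∘ σa) t
  | .var _, _, _, _, _, _, _ => rfl
  | .lam S t, _, _, _, _, _, _ => by
      simp [subTm, subTy_subTy, subTm_subTm t, subTm_comp_liftSubX, subKEnt_comp_shiftSubKx]
  | .app a b, _, _, _, _, _, _ => by simp [subTm, subTm_subTm a, subTm_subTm b]
  | .tlam t, _, _, _, _, _, _ => by
      simp [subTm, subTm_subTm t, subTy_liftTySub_comp_liftTySub, subTm_comp_shiftSubXa,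
        subKEnt_comp_shiftSubKa]
  | .tapp t S, _, _, _, _, _, _ => by simp [subTm, subTy_subTy, subTm_subTm t]
  | .shift t, _, _, _, _, _, _ => by
      simp [subTm, subTm_subTm t, subKEnt_comp_liftSubK, subTm_comp_shiftSubXk]
  | .reset t, _, _, _, _, _, _ => by simp [subTm, subTm_subTm t]
  | .throwVar k t, _, _, _, _, σk, _ => by
      simp only [subTm, Function.comp_apply]
      cases σk k <;> simp [subTm, subKEnt, subTm_subTm t]
  | .throwCtx E t, _, _, _, _, _, _ => by simp [subTm, subTm_subTm t, subCtx_subCtx E]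

theorem subCtx_subCtx : ∀ (E : Ctx) (τx : Nat → Tm) (τk : Nat → Ctx ⊕ Nat) (τa : Nat → Ty)
    (σx : Nat → Tm) (σk : Nat → Ctx ⊕ Nat) (σa : Nat → Ty),
    subCtx τx τk τa (subCtx σx σk σa E) =
      subCtx (subTm τx τk τa ∘ σx) (subKEnt τx τk τa ∘ σk) (subTy τa ∘ σa) E
  | .hole, _, _, _, _, _, _ => rfl
  | .lamApp S t E, _, _, _, _, _, _ => by
      simp [subCtx, subTy_subTy, subTm_subTm t, subCtx_subCtx E, subTm_comp_liftSubX,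
        subKEnt_comp_shiftSubKx]
  | .app E t, _, _, _, _, _, _ => by simp [subCtx, subTm_subTm t, subCtx_subCtx E]
  | .tapp E S, _, _, _, _, _, _ => by simp [subCtx, subTy_subTy, subCtx_subCtx E]
  | .throw E0 E, _, _, _, _, _, _ => by simp [subCtx, subCtx_subCtx E0, subCtx_subCtx E]
end

theorem liftSubX_var : liftSubX Tm.var = Tm.var := by
  funext n; cases n <;> rfl

theorem liftSubK_inr : liftSubK Sum.inr = Sum.inr := by
  funext n; cases n <;> rfl

theorem shiftSubXk_var : shiftSubXk Tm.var = Tm.var := rfl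

theorem shiftSubXa_var : shiftSubXa Tm.var = Tm.var := rfl

theorem shiftSubKx_inr : shiftSubKx Sum.inr = Sum.inr := rfl

theorem shiftSubKa_inr : shiftSubKa Sum.inr = Sum.inr := rfl

mutual
theorem subTm_id : ∀ t : Tm, subTm Tm.var Sum.inr Ty.var t = t
  | .var _ => rfl
  | .lam S t => by simp [subTm, subTy_var, subTm_id t, liftSubX_var, shiftSubKx_inr]
  | .app a b => by simp [subTm, subTm_id a, subTm_id b]
  | .tlam t => by simp [subTm, subTm_id t, liftTySub_var, shiftSubXa_var, shiftSubKa_inr]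
  | .tapp t S => by simp [subTm, subTy_var, subTm_id t]
  | .shift t => by simp [subTm, subTm_id t, liftSubK_inr, shiftSubXk_var]
  | .reset t => by simp [subTm, subTm_id t]
  | .throwVar k t => by simp [subTm, subTm_id t]
  | .throwCtx E t => by simp [subTm, subTm_id t, subCtx_id E]

theorem subCtx_id : ∀ E : Ctx, subCtx Tm.var Sum.inr Ty.var E = E
  | .hole => rfl
  | .lamApp S t E => by
      simp [subCtx, subTy_var, subTm_id t, subCtx_id E, liftSubX_var, shiftSubKx_inr]
  | .app E t => by simp [subCtx, subTm_id t, subCtx_id E]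
  | .tapp E S => by simp [subCtx, subTy_var, subCtx_id E]
  | .throw E0 E => by simp [subCtx, subCtx_id E0, subCtx_id E]
end

theorem sub0X_subTm (v : Tm) (σx : Nat → Tm) (σk : Nat → Ctx ⊕ Nat) (σa : Nat → Ty) (t : Tm) :
    sub0X v (subTm (liftSubX σx) (shiftSubKx σk) σa t) = subTm (scons v σx) σk σa t := by
  rw [sub0X, subTm_subTm]
  congr 1
  · funext n
    cases n with
    | zero => rfl
    | succ n => exact (subTm_renTm _ _ _ _ _ _ _).trans (subTm_id _)
  · funext n
    simp only [Function.comp_apply, shiftSubKx]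
    cases σk n with
    | inr m => rfl
    | inl E => exact congrArg Sum.inl ((subCtx_renCtx _ _ _ _ _ _ _).trans (subCtx_id _))
  · funext n; exact subTy_var _

theorem sub0A_subTm (V : Ty) (σx : Nat → Tm) (σk : Nat → Ctx ⊕ Nat) (σa : Nat → Ty) (t : Tm) :
    sub0A V (subTm (shiftSubXa σx) (shiftSubKa σk) (liftTySub σa) t) =
      subTm σx σk (scons V σa) t := by
  rw [sub0A, subTm_subTm]
  congr 1
  · funext n; exact (subTm_renTm _ _ _ _ _ _ _).trans (subTm_id _)
  · funext n
    simp only [Function.comp_apply, shiftSubKa]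
    cases σk n with
    | inr m => rfl
    | inl E => exact congrArg Sum.inl ((subCtx_renCtx _ _ _ _ _ _ _).trans (subCtx_id _))
  · funext n
    cases n with
    | zero => rfl
    | succ n => exact (subTy_renTy _ _ _).trans (subTy_var _)

theorem sub0K_subTm (E : Ctx) (σx : Nat → Tm) (σk : Nat → Ctx ⊕ Nat) (σa : Nat → Ty) (t : Tm) :
    sub0K E (subTm (shiftSubXk σx) (liftSubK σk) σa t) =
      subTm σx (scons (Sum.inl E) σk) σa t := by
  rw [sub0K, subTm_subTm]
  congr 1
  · funext n; exact (subTm_renTm _ _ _ _ _ _ _).trans (subTm_id _)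
  · funext n
    cases n with
    | zero => rfl
    | succ n =>
      simp only [Function.comp_apply, liftSubK_succ, scons]
      cases σk n with
      | inr m => rfl
      | inl E => exact congrArg Sum.inl ((subCtx_renCtx _ _ _ _ _ _ _).trans (subCtx_id _))
  · funext n; exact subTy_var _

/-! ### An untyped reducibility interpretation

Types do not influence reduction, so candidates may be arbitrary sets of values, with no typing
or closedness condition; this makes the interpretation insensitive to free type variables. -/

/-- `(R,R') ⊨ E`, with the metacontexts ranging over all metacontexts. -/
def CtxSem (R R' : Set Tm) (E : Ctx) : Prop :=
  ∀ v ∈ R, ∀ F, MCtxOK R' F → Norm (plugm v (E::F))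

/-- Untyped parametric reducibility candidates. -/
def Sem : Ty → (Nat → Set Tm) → Set Tm
  | .var i, η => η i
  | .arrow S T U V, η =>
      {v0 | (∃ A b, v0 = .lam A b) ∧ ∀ v1 ∈ Sem S η,
        ∀ E, CtxSem (Sem T η) (Sem U η) E → ∀ F, MCtxOK (Sem V η) F →
          Norm (plugm (.app v0 v1) (E::F))}
  | .all S T U, η =>
      {v | (∃ b, v = .tlam b) ∧ ∀ (V : Ty) (R : Set Tm), (∀ w ∈ R, IsValue w) →
        ∀ E, CtxSem (Sem S (scons R η)) (Sem T (scons R η)) E →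
          ∀ F, MCtxOK (Sem U (scons R η)) F → Norm (plugm (.tapp v V) (E::F))}

theorem IsValue.of_mem_sem {S : Ty} {η : Nat → Set Tm} (hη : ∀ n, ∀ w ∈ η n, IsValue w) {v : Tm}
    (hv : v ∈ Sem S η) : IsValue v := by
  cases S with
  | var i => exact hη i v hv
  | arrow S T U V => obtain ⟨⟨A, b, rfl⟩, -⟩ := hv; exact .lam
  | all S T U => obtain ⟨⟨b, rfl⟩, -⟩ := hv; exact .tlam

theorem scons_comp_liftRen {α : Type*} (a : α) (f : Nat → α) (ρ : Nat → Nat) :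
    scons a f ∘ liftRen ρ = scons a (f ∘ ρ) := by
  funext n; cases n <;> rfl

theorem sem_renTy (S : Ty) (ρ : Nat → Nat) (η : Nat → Set Tm) :
    Sem (renTy ρ S) η = Sem S (η ∘ ρ) := by
  induction S generalizing ρ η with
  | var => rfl
  | arrow _ _ _ _ iha ihb ihc ihd => simp only [renTy, Sem, iha, ihb, ihc, ihd]
  | all _ _ _ iha ihb ihc => simp only [renTy, Sem, iha, ihb, ihc, scons_comp_liftRen]

theorem sem_renTy_succ (S : Ty) (R : Set Tm) (η : Nat → Set Tm) :
    Sem (renTy Nat.succ S) (scons R η) = Sem S η :=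
  sem_renTy _ _ _

theorem sem_liftTySub (σ : Nat → Ty) (R : Set Tm) (η : Nat → Set Tm) :
    (fun n => Sem (liftTySub σ n) (scons R η)) = scons R (fun n => Sem (σ n) η) := by
  funext n
  cases n with
  | zero => rfl
  | succ n => exact sem_renTy_succ _ _ _

theorem sem_subTy (S : Ty) (σ : Nat → Ty) (η : Nat → Set Tm) :
    Sem (subTy σ S) η = Sem S (fun n => Sem (σ n) η) := by
  induction S generalizing σ η with
  | var => rfl
  | arrow _ _ _ _ iha ihb ihc ihd => simp only [subTy, Sem, iha, ihb, ihc, ihd]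
  | all _ _ _ iha ihb ihc => simp only [subTy, Sem, iha, ihb, ihc, sem_liftTySub]

theorem sem_subTy0 (V S : Ty) (η : Nat → Set Tm) :
    Sem (subTy0 V S) η = Sem S (scons (Sem V η) η) := by
  rw [subTy0, sem_subTy]
  congr 1
  funext n; cases n <;> rfl

/-- Term and continuation substitutions interpreting the contexts `Γ` and `Δ`. -/
structure SubSem (Γ : List Ty) (Δ : List (Ty × Ty)) (η : Nat → Set Tm) (σx : Nat → Tm)
    (σk : Nat → Ctx ⊕ Nat) : Prop where
  value : ∀ n, ∀ w ∈ η n, IsValue w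
  tm : ∀ x A, Γ[x]? = some A → σx x ∈ Sem A η
  ctx : ∀ k A B, Δ[k]? = some (A, B) → ∃ E, σk k = .inl E ∧ CtxSem (Sem A η) (Sem B η) E

theorem SubSem.consX {Γ : List Ty} {Δ : List (Ty × Ty)} {η : Nat → Set Tm} {σx : Nat → Tm}
    {σk : Nat → Ctx ⊕ Nat} (h : SubSem Γ Δ η σx σk) {A : Ty} {v : Tm} (hv : v ∈ Sem A η) :
    SubSem (A :: Γ) Δ η (scons v σx) σk where
  value := h.value
  tm
    | 0, B, hB => by simp at hB; subst hB; exact hv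
    | x+1, B, hB => h.tm x B (by simpa using hB)
  ctx := h.ctx

theorem SubSem.consK {Γ : List Ty} {Δ : List (Ty × Ty)} {η : Nat → Set Tm} {σx : Nat → Tm}
    {σk : Nat → Ctx ⊕ Nat} (h : SubSem Γ Δ η σx σk) {A B : Ty} {E : Ctx}
    (hE : CtxSem (Sem A η) (Sem B η) E) :
    SubSem Γ ((A, B) :: Δ) η σx (scons (.inl E) σk) where
  value := h.value
  tm := h.tm
  ctx
    | 0, A', B', hB => by
        simp at hB
        obtain ⟨rfl, rfl⟩ := hB
        exact ⟨E, rfl, hE⟩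
    | k+1, A', B', hB => h.ctx k A' B' (by simpa using hB)

theorem SubSem.consA {Γ : List Ty} {Δ : List (Ty × Ty)} {η : Nat → Set Tm} {σx : Nat → Tm}
    {σk : Nat → Ctx ⊕ Nat} (h : SubSem Γ Δ η σx σk) {R : Set Tm} (hR : ∀ w ∈ R, IsValue w) :
    SubSem (Γ.map (renTy Nat.succ))
      (Δ.map (fun C => (renTy Nat.succ C.1, renTy Nat.succ C.2))) (scons R η) σx σk where
  value
    | 0 => hR
    | n+1 => h.value n
  tm x A hA := by
    rw [List.getElem?_map, Option.map_eq_some_iff] at hA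
    obtain ⟨A, hA, rfl⟩ := hA
    rw [sem_renTy_succ]
    exact h.tm x A hA
  ctx k A B hC := by
    rw [List.getElem?_map, Option.map_eq_some_iff] at hC
    obtain ⟨⟨A, B⟩, hC, h'⟩ := hC
    cases h'
    simp only [sem_renTy_succ]
    exact h.ctx k A B hC

theorem Norm.of_step {p q : Tm} (h : Step p q) (hq : Norm q) : Norm p := by
  obtain ⟨v, hv, hs⟩ := hq
  exact ⟨v, hv, .head h hs⟩

theorem MCtxOK.cons {R R' : Set Tm} {E : Ctx} {F : MCtx} (hR : ∀ w ∈ R, IsValue w)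
    (hE : CtxSem R R' E) (hF : MCtxOK R' F) : MCtxOK R (E :: F) :=
  fun w hw => .of_step (.reset (hR w hw)) (hE w hw F hF)

theorem ctxSem_hole (R : Set Tm) : CtxSem R R .hole := fun v hv _ hF => hF v hv

theorem CtxSem.throw {R R' R'' : Set Tm} {E' E : Ctx} (hR : ∀ w ∈ R, IsValue w)
    (hR' : ∀ w ∈ R', IsValue w) (hE' : CtxSem R R' E') (hE : CtxSem R' R'' E) :
    CtxSem R R'' (.throw E' E) :=
  fun v hv _ hF => .of_step (.throw (hR v hv)) (hE' v hv _ (.cons hR' hE hF))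

theorem CtxSem.tapp {S T U V : Ty} {η : Nat → Set Tm} (hη : ∀ n, ∀ w ∈ η n, IsValue w) {E : Ctx}
    (hE : CtxSem (Sem (subTy0 V S) η) (Sem (subTy0 V T) η) E) (V' : Ty) :
    CtxSem (Sem (.all S T U) η) (Sem (subTy0 V U) η) (.tapp E V') := by
  simp only [sem_subTy0] at hE ⊢
  exact fun v hv F hF => hv.2 V' _ (fun _ => .of_mem_sem hη) E hE F hF

theorem CtxSem.lamApp {S T U V A : Ty} {b : Tm} {η : Nat → Set Tm} {E : Ctx}
    (hb : .lam A b ∈ Sem (.arrow S T U V) η) (hE : CtxSem (Sem T η) (Sem U η) E) :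
    CtxSem (Sem S η) (Sem V η) (.lamApp A b E) :=
  fun v hv F hF => hb.2 v hv E hE F hF

/-- The term `t` is reducible at value type `S`, initial answer type `T` and final answer
type `U`; a value is moreover in the interpretation of its type. -/
def TmSem (η : Nat → Set Tm) (T : Ty) (t : Tm) (S U : Ty) : Prop :=
  (IsValue t → t ∈ Sem S η) ∧
    ∀ E, CtxSem (Sem S η) (Sem T η) E → ∀ F, MCtxOK (Sem U η) F → Norm (plugm t (E::F))

theorem TmSem.of_mem {η : Nat → Set Tm} {t : Tm} {S T : Ty} (h : t ∈ Sem S η) :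
    TmSem η T t S T :=
  ⟨fun _ => h, fun _ hE F hF => hE t h F hF⟩

theorem CtxSem.app {S T U V W : Ty} {t : Tm} {η : Nat → Set Tm} {E : Ctx}
    (hE : CtxSem (Sem T η) (Sem U η) E) (ht : TmSem η V t S W) :
    CtxSem (Sem (.arrow S T U V) η) (Sem W η) (.app E t) := by
  rintro v hv F hF
  obtain ⟨A, b, rfl⟩ := hv.1
  exact ht.2 (.lamApp A b E) (.lamApp hv hE) F hF

mutual
/-- Every typed term is reducible under a reducible substitution. -/
theorem HasTy.tmSem {Γ : List Ty} {Δ : List (Ty × Ty)} {T : Ty} {t : Tm} {S U : Ty}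
    (h : HasTy Γ Δ T t S U) (η : Nat → Set Tm) (σx : Nat → Tm) (σk : Nat → Ctx ⊕ Nat)
    (σa : Nat → Ty) (hσ : SubSem Γ Δ η σx σk) : TmSem η T (subTm σx σk σa t) S U :=
  match h with
  | .var hx => .of_mem (hσ.tm _ _ hx)
  | .lam ht => .of_mem ⟨⟨_, _, rfl⟩, fun v hv E hE F hF => by
      refine .of_step (.beta (.of_mem_sem hσ.value hv)) ?_
      rw [sub0X_subTm]
      exact (HasTy.tmSem ht η _ _ σa (hσ.consX hv)).2 E hE F hF⟩
  | .app h0 h1 => ⟨nofun, fun E hE F hF =>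
      (HasTy.tmSem h0 η σx σk σa hσ).2 (.app E _)
        (.app hE (HasTy.tmSem h1 η σx σk σa hσ)) F hF⟩
  | .tlam ht => .of_mem ⟨⟨_, rfl⟩, fun V R hR E hE F hF => by
      refine .of_step .betaT ?_
      rw [sub0A_subTm]
      exact (HasTy.tmSem ht (scons R η) σx σk (scons V σa) (hσ.consA hR)).2 E hE F hF⟩
  | .tapp ht => ⟨nofun, fun E hE F hF =>
      (HasTy.tmSem ht η σx σk σa hσ).2 (.tapp E _) (.tapp hσ.value hE _) F hF⟩
  | .reset ht => ⟨nofun, fun E hE F hF =>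
      (HasTy.tmSem ht η σx σk σa hσ).2 .hole (ctxSem_hole _) (E :: F)
        (.cons (fun _ => .of_mem_sem hσ.value) hE hF)⟩
  | .shift ht => ⟨nofun, fun E hE F hF => by
      refine .of_step .shift ?_
      rw [sub0K_subTm]
      exact (HasTy.tmSem ht η _ _ σa (hσ.consK hE)).2 .hole (ctxSem_hole _) F hF⟩
  | .throwVar hk ht => by
      obtain ⟨E', hkE, hE'⟩ := hσ.ctx _ _ _ hk
      simp only [subTm, hkE]
      exact ⟨nofun, fun E hE F hF =>
        (HasTy.tmSem ht η σx σk σa hσ).2 (.throw E' E)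
          (.throw (fun _ => .of_mem_sem hσ.value) (fun _ => .of_mem_sem hσ.value) hE' hE) F hF⟩
  | .throwCtx hE' ht => ⟨nofun, fun E hE F hF =>
      (HasTy.tmSem ht η σx σk σa hσ).2 (.throw _ E)
        (.throw (fun _ => .of_mem_sem hσ.value) (fun _ => .of_mem_sem hσ.value)
          (HasTyCtx.ctxSem hE' η σx σk σa hσ) hE) F hF⟩

/-- Every typed context is reducible under a reducible substitution. -/
theorem HasTyCtx.ctxSem {Γ : List Ty} {Δ : List (Ty × Ty)} {E : Ctx} {S T : Ty}
    (h : HasTyCtx Γ Δ E S T) (η : Nat → Set Tm) (σx : Nat → Tm) (σk : Nat → Ctx ⊕ Nat)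
    (σa : Nat → Ty) (hσ : SubSem Γ Δ η σx σk) :
    CtxSem (Sem S η) (Sem T η) (subCtx σx σk σa E) :=
  match h with
  | .hole => ctxSem_hole _
  | .app hE ht => .app (HasTyCtx.ctxSem hE η σx σk σa hσ) (HasTy.tmSem ht η σx σk σa hσ)
  | .lamApp ht hE =>
      .lamApp ((HasTy.tmSem ht η σx σk σa hσ).1 .lam) (HasTyCtx.ctxSem hE η σx σk σa hσ)
  | .tapp hE => .tapp hσ.value (HasTyCtx.ctxSem hE η σx σk σa hσ) _
  | .throw hE' hE =>
      .throw (fun _ => .of_mem_sem hσ.value) (fun _ => .of_mem_sem hσ.value)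
        (HasTyCtx.ctxSem hE' η σx σk σa hσ) (HasTyCtx.ctxSem hE η σx σk σa hσ)
end

theorem SubSem.nil {η : Nat → Set Tm} (hη : ∀ n, ∀ w ∈ η n, IsValue w) (σx : Nat → Tm)
    (σk : Nat → Ctx ⊕ Nat) : SubSem [] [] η σx σk :=
  ⟨hη, nofun, nofun⟩

theorem HasTyCtx.ctxSem_closed {E : Ctx} {S T : Ty} (h : HasTyCtx [] [] E S T)
    {η : Nat → Set Tm} (hη : ∀ n, ∀ w ∈ η n, IsValue w) : CtxSem (Sem S η) (Sem T η) E := by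
  simpa only [subCtx_id] using h.ctxSem η Tm.var Sum.inr Ty.var (.nil hη _ _)

theorem HasTy.mem_sem_closed {v : Tm} {S T U : Ty} (h : HasTy [] [] T v S U) (hv : IsValue v)
    {η : Nat → Set Tm} (hη : ∀ n, ∀ w ∈ η n, IsValue w) : v ∈ Sem S η := by
  have := h.tmSem η Tm.var Sum.inr Ty.var (.nil hη _ _)
  rw [subTm_id] at this
  exact this.1 hv

theorem HasTyMCtx.mctxOK_closed {F : MCtx} {S : Ty} (h : HasTyMCtx [] [] F S)
    {η : Nat → Set Tm} (hη : ∀ n, ∀ w ∈ η n, IsValue w) : MCtxOK (Sem S η) F := by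
  induction F generalizing S with
  | nil => exact fun w hw => ⟨w, .of_mem_sem hη hw, .refl⟩
  | cons E F ih =>
    cases h with
    | cons hE hF => exact .cons (fun _ => .of_mem_sem hη) (hE.ctxSem_closed hη) (ih hF)

/-- **Main lemma for call-by-value `λF_{S,v}`** (Lemma 5).
Let `t` be a plain term with `Γ;Δ,T ⊢ t : S,U`, where `Γ = x₁:T₁,…,xₙ:Tₙ`
and `Δ = k₁:¬(W₁¹,W₁²),…,k_m:¬(W_m¹,W_m²)`; let all free type variables of
`S`, `T`, `U`, `Γ`, `Δ` be among `α₁,…,α_p` (de Bruijn: `< Vs.length`); let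
`V̄` be `p` types and `R̄` reducibility candidates with `Rᵢ ∈ RC(Vᵢ)`; let
`v̄` be closed values with `⊢ vᵢ : Tᵢ[ᾱ:=V̄]` (at any answer type `W`) and
`vᵢ ∈ RED_{Tᵢ}(ᾱ↦R̄)`; let `Ē` be closed contexts with `⊢ Eᵢ : ¬(Wᵢ¹,Wᵢ²)`
and `(RED_{Wᵢ¹}(ᾱ↦R̄), RED_{Wᵢ²}(ᾱ↦R̄)) ⊨ Eᵢ`; let `E` be a closed context
with `⊢ E : ¬(S,T)` and `(RED_S(ᾱ↦R̄), RED_T(ᾱ↦R̄)) ⊨ E`; and let `F` be a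
closed metacontext with `⊢ F : ¬¬U` and `RED_U(ᾱ↦R̄) ⊨⊨ F`.  Then
`norm (F[⟨E[t[ᾱ:=V̄][x̄:=v̄][k̄:=⌈Ē⌉]]⟩])` holds. -/
theorem main_lemma_cbv
    (Γ : List Ty) (Δ : List (Ty × Ty)) (T : Ty) (t : Tm) (S U : Ty)
    (Vs : List Ty) (Rs : List (Set Tm)) (vs : List Tm) (Es : List Ctx)
    (E : Ctx) (F : MCtx)
    (hplain : Plain t)
    (hty : HasTy Γ Δ T t S U)
    (hscS : ScopedTy Vs.length S)
    (hscT : ScopedTy Vs.length T)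
    (hscU : ScopedTy Vs.length U)
    (hscΓ : ∀ A ∈ Γ, ScopedTy Vs.length A)
    (hscΔ : ∀ C ∈ Δ, ScopedTy Vs.length C.1 ∧ ScopedTy Vs.length C.2)
    (hlenR : Vs.length = Rs.length)
    (hcand : ∀ i < Vs.length, IsCand (Vs.getD i (.var 0)) (Rs.getD i ∅))
    (hlenv : vs.length = Γ.length)
    (hvals : ∀ i < Γ.length,
      IsValue (vs.getD i (.var 0)) ∧ ClosedTm (vs.getD i (.var 0)) ∧
      (∀ W, HasTy [] [] W (vs.getD i (.var 0)) (subTyList Vs (Γ.getD i (.var 0))) W) ∧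
      vs.getD i (.var 0) ∈ RED (Γ.getD i (.var 0)) Vs Rs)
    (hlenE : Es.length = Δ.length)
    (hctxs : ∀ i < Δ.length,
      ClosedCtx (Es.getD i .hole) ∧
      HasTyCtx [] [] (Es.getD i .hole) (Δ.getD i (.var 0, .var 0)).1 (Δ.getD i (.var 0, .var 0)).2 ∧
      CtxOK (subTyList Vs (Δ.getD i (.var 0, .var 0)).2)
        (RED (Δ.getD i (.var 0, .var 0)).1 Vs Rs)
        (RED (Δ.getD i (.var 0, .var 0)).2 Vs Rs)
        (Es.getD i .hole))
    (hE : ClosedCtx E ∧ HasTyCtx [] [] E S T ∧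
      CtxOK (subTyList Vs T) (RED S Vs Rs) (RED T Vs Rs) E)
    (hF : ClosedMCtx F ∧ HasTyMCtx [] [] F U ∧ MCtxOK (RED U Vs Rs) F) :
    Norm (plugm (msub Vs vs Es t) (E::F)) := by
  have hη : ∀ n, ∀ w ∈ Sem (Vs.getD n (.var n)) (fun _ => ∅), IsValue w :=
    fun n w hw => .of_mem_sem (fun _ _ h => h.elim) hw
  refine (hty.tmSem (fun n => Sem (Vs.getD n (.var n)) (fun _ => ∅)) _ _ _ ⟨hη, ?_, ?_⟩).2
    E (hE.2.1.ctxSem_closed hη) F (hF.2.1.mctxOK_closed hη)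
  · intro x A hA
    obtain ⟨hx, rfl⟩ := List.getElem?_eq_some_iff.mp hA
    obtain ⟨hv, -, hvty, -⟩ := hvals x hx
    have hmem := (hvty (.var 0)).mem_sem_closed hv (η := fun _ => ∅) (fun _ _ h => h.elim)
    rw [subTyList, sem_subTy] at hmem
    simpa [hx, hlenv ▸ hx] using hmem
  · intro k A B hC
    obtain ⟨hk, hkC⟩ := List.getElem?_eq_some_iff.mp hC
    have hkE : k < Es.length := hlenE ▸ hk
    refine ⟨Es[k], by simp [hkE], ?_⟩
    have hEk := (hctxs k hk).2.1
    simp only [List.getD_eq_getElem?_getD, hC, List.getElem?_eq_getElem hkE,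
      Option.getD_some] at hEk
    exact hEk.ctxSem_closed hη

end LambdaFShift
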